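/- arXiv:1707.06269 — 2 statements merged into one kernel-verified Lean document; each statement's English description precedes it below -/
import Mathlib

section
/- (Uspenskii) If κ is an infinite cardinal less than the first measurable cardinal, then every ω-continuous function f : {0,1}^κ → ℝ is continuous; that is, t₀({0,1}^κ) = ω. -/
open Cardinal Set

/-- A type carries a "measurable" ultrafilter if it has a nonprincipal
countably complete ultrafilter. -/
def HasCountablyCompleteNonprincipalUltrafilter (α : Type*) : Prop :=
  ∃ U : Ultrafilter α, (∀ a : α, (U : Ultrafilter α) ≠ pure a) ∧
    ∀ s : ℕ → Set α, (∀ n, s n ∈ U) → (⋂ n, s n) ∈ U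

namespace Usp

open Filter Topology

/-- ContinuousOn version of countable continuity. -/
def WC {X : Type*} [TopologicalSpace X] (f : X → ℝ) : Prop :=
  ∀ A : Set X, A.Countable → ContinuousOn f A

lemma WC.comp {X Y : Type*} [TopologicalSpace X] [TopologicalSpace Y] {f : X → ℝ} (hf : WC f)
    {e : Y → X} (he : Continuous e) : WC (fun y => f (e y)) := by
  intro A hA
  exact (hf (e '' A) (hA.image e)).comp he.continuousOn (Set.mapsTo_image e A)

lemma WC.continuous {X : Type*} [TopologicalSpace X] [TopologicalSpace.SeparableSpace X]
    {f : X → ℝ} (hf : WC f) : Continuous f := by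
  obtain ⟨D, hDc, hD⟩ := TopologicalSpace.exists_countable_dense X
  rw [continuous_iff_continuousAt]
  intro x
  rw [ContinuousAt, Metric.tendsto_nhds]
  intro ε hε
  have h1 : ContinuousWithinAt f (insert x D) x :=
    hf _ (hDc.insert x) x (Set.mem_insert _ _)
  have h2 := (Metric.tendsto_nhds.1 h1) (ε / 2) (by positivity)
  rw [eventually_nhdsWithin_iff] at h2
  obtain ⟨U, hU, hUo, hxU⟩ := eventually_nhds_iff.1 h2
  refine eventually_nhds_iff.2 ⟨U, ?_, hUo, hxU⟩
  intro y hy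
  have h3 : ContinuousWithinAt f (insert y D) y :=
    hf _ (hDc.insert y) y (Set.mem_insert _ _)
  have h4 : ContinuousWithinAt f (U ∩ D) y :=
    h3.mono (Set.inter_subset_right.trans (Set.subset_insert _ _))
  have h5 : y ∈ closure (U ∩ D) := hD.open_subset_closure_inter hUo hy
  have h6 := h4.mem_closure_image h5
  have h7 : f '' (U ∩ D) ⊆ Metric.closedBall (f x) (ε / 2) := by
    rintro _ ⟨z, ⟨hz, hzD⟩, rfl⟩
    exact (hU z hz (Set.mem_insert_of_mem _ hzD)).le
  have h8 := closure_minimal h7 Metric.isClosed_closedBall h6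
  rw [Metric.mem_closedBall] at h8
  linarith

lemma sep (K : Type*) [Countable K] : TopologicalSpace.SeparableSpace ((K → Bool) → Bool) := by
  classical
  let R : (Σ s : Finset K, (((s → Bool)) → Bool)) → ((K → Bool) → Bool) :=
    fun p j => p.2 (fun k => j k)
  refine ⟨⟨Set.range R, Set.countable_range R, ?_⟩⟩
  intro w
  rw [mem_closure_iff]
  intro O hO hw
  obtain ⟨I, u, hu, hbox⟩ := isOpen_pi_iff.1 hO w hw
  -- a finite set of coordinates separating I
  have : ∃ s : Finset K, ∀ a ∈ I, ∀ b ∈ I, (∀ k ∈ s, a k = b k) → a = b := by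
    have hc : ∀ a b : K → Bool, ∃ k : Finset K, (∀ l ∈ k, a l = b l) → a = b := by
      intro a b
      by_cases h : a = b
      · exact ⟨∅, fun _ => h⟩
      · obtain ⟨k, hk⟩ := Function.ne_iff.1 h
        exact ⟨{k}, fun h' => absurd (h' k (by simp)) hk⟩
    choose k hk using hc
    refine ⟨I.biUnion fun a => I.biUnion fun b => k a b, ?_⟩
    intro a ha b hb h
    apply hk
    intro l hl
    apply h
    simp only [Finset.mem_biUnion]
    exact ⟨a, ha, b, hb, hl⟩
  obtain ⟨s, hs⟩ := this
  let φ : (s → Bool) → Bool := fun q =>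
    if h : ∃ a ∈ I, (fun k : s => a k) = q then w h.choose else false
  refine ⟨R ⟨s, φ⟩, hbox ?_, Set.mem_range_self _⟩
  intro a ha
  have hex : ∃ b ∈ I, (fun k : s => b k) = (fun k : s => a k) := ⟨a, ha, rfl⟩
  have e : R ⟨s, φ⟩ a = w hex.choose := by
    simp only [R, φ]
    rw [dif_pos hex]
  have e2 : hex.choose = a := by
    apply hs _ hex.choose_spec.1 _ ha
    intro k hk
    exact congrFun hex.choose_spec.2 ⟨k, hk⟩
  rw [e, e2]
  exact (hu a ha).2

variable {ι : Type*}

lemma WC.pull {f : (ι → Bool) → ℝ} (hf : WC f) {K : Type*} [Countable K] (h : ι → (K → Bool)) :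
    Continuous (fun u : (K → Bool) → Bool => f (fun i => u (h i))) := by
  have := sep K
  apply WC.continuous
  exact hf.comp (e := fun (u : (K → Bool) → Bool) i => u (h i)) (by fun_prop)

/-- f varies by more than ε along the coordinates in B. -/
def Ess (f : (ι → Bool) → ℝ) (ε : ℝ) (B : Set ι) : Prop :=
  ∃ x y : ι → Bool, (∀ i, i ∉ B → x i = y i) ∧ ε < |f x - f y|

lemma Ess.mono {f : (ι → Bool) → ℝ} {ε δ : ℝ} {B C : Set ι} (h : Ess f ε B) (hBC : B ⊆ C)
    (hd : δ ≤ ε) : Ess f δ C := by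
  obtain ⟨x, y, h1, h2⟩ := h
  exact ⟨x, y, fun i hi => h1 i (fun h => hi (hBC h)), lt_of_le_of_lt hd h2⟩

lemma Ess.exists_nat {f : (ι → Bool) → ℝ} {B : Set ι} (h : Ess f 0 B) :
    ∃ n : ℕ, Ess f (1 / ((n : ℝ) + 1)) B := by
  obtain ⟨x, y, h1, h2⟩ := h
  obtain ⟨n, hn⟩ := exists_nat_one_div_lt h2
  exact ⟨n, x, y, h1, hn⟩

lemma no_seq {f : (ι → Bool) → ℝ} (hf : WC f) {ε : ℝ} (hε : 0 < ε) (B : ℕ → Set ι)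
    (hB : ∀ m n, m ≠ n → Disjoint (B m) (B n)) (hE : ∀ n, Ess f ε (B n)) : False := by
  choose x y hxy hgap using hE
  let h : ι → (ℕ × Bool → Bool) := fun i p => cond p.2 (x p.1 i) (y p.1 i)
  have hg := hf.pull h
  set g := (fun u : (ℕ × Bool → Bool) → Bool => f (fun i => u (h i))) with hgdef
  let u : ℕ → (ℕ × Bool → Bool) → Bool := fun n j => j (n, true)
  let v : ℕ → (ℕ × Bool → Bool) → Bool := fun n j => j (n, false)
  have hu : ∀ n, g (u n) = f (x n) := fun n => rfl
  have hv : ∀ n, g (v n) = f (y n) := fun n => rfl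
  let W : Ultrafilter ℕ := hyperfilter ℕ
  have hu0 : Tendsto u W (𝓝 (W.map u).lim) := (W.map u).le_nhds_lim
  have hv0 : Tendsto v W (𝓝 (W.map v).lim) := (W.map v).le_nhds_lim
  set u0 := (W.map u).lim
  set v0 := (W.map v).lim
  have heq : g u0 = g v0 := by
    have : (fun i => u0 (h i)) = (fun i => v0 (h i)) := by
      funext i
      have a := (tendsto_pi_nhds.1 hu0) (h i)
      have b := (tendsto_pi_nhds.1 hv0) (h i)
      refine tendsto_nhds_unique_of_eventuallyEq a b ?_
      have hfin : {n | u n (h i) ≠ v n (h i)}.Finite := by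
        apply Set.Subsingleton.finite
        intro m hm n hn
        by_contra hmn
        have h1 : i ∈ B m := by
          by_contra hi
          exact hm (hxy m i hi)
        have h2 : i ∈ B n := by
          by_contra hi
          exact hn (hxy n i hi)
        exact Set.disjoint_left.1 (hB m n hmn) h1 h2
      have := hfin.compl_mem_hyperfilter
      filter_upwards [this] with n hn
      simpa using hn
    exact congrArg f this
  have t1 : Tendsto (fun n => |f (x n) - f (y n)|) W (𝓝 |g u0 - g v0|) :=
    (((hg.tendsto u0).comp hu0).sub ((hg.tendsto v0).comp hv0)).abs
  have t2 : ε ≤ |g u0 - g v0| := ge_of_tendsto t1 (Eventually.of_forall fun n => (hgap n).le)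
  rw [heq, sub_self, abs_zero] at t2
  linarith

lemma piece {f : (ι → Bool) → ℝ} (hf : WC f) {K : Type*} [Countable K] (h : ι → (K → Bool))
    {B : Set ι} (hB : Ess f 0 B) : ∃ p, Ess f 0 (B ∩ h ⁻¹' {p}) := by
  classical
  by_contra! hno
  obtain ⟨x, y, hxy, hgap⟩ := hB
  let h' : ι → (K ⊕ Bool → Bool) := fun i => Sum.elim (h i) (fun b => cond b (x i) (y i))
  have hg := hf.pull h'
  set g := (fun u : (K ⊕ Bool → Bool) → Bool => f (fun i => u (h' i))) with hgdef
  let u : (K ⊕ Bool → Bool) → Bool := fun j => j (Sum.inr true)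
  let v : (K ⊕ Bool → Bool) → Bool := fun j => j (Sum.inr false)
  have hu : g u = f x := rfl
  have hv : g v = f y := rfl
  have key : ∀ F : Finset (K ⊕ Bool → Bool), g (F.piecewise v u) = g u := by
    intro F
    induction F using Finset.induction_on with
    | empty => simp
    | insert j F hj ih =>
      rw [← ih]
      by_contra hne
      apply hno (fun k => j (Sum.inl k))
      refine ⟨_, _, ?_, abs_pos.2 (sub_ne_zero.2 hne)⟩
      intro i hi
      by_cases hij : h' i = j
      · have hiB : i ∉ B := by
          intro hiB
          apply hi
          refine ⟨hiB, ?_⟩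
          simp only [Set.mem_preimage, Set.mem_singleton_iff]
          rw [← hij]
          rfl
        have huv : v (h' i) = u (h' i) := (hxy i hiB).symm
        simp only [Finset.piecewise]
        split_ifs <;> simp [huv]
      · simp [Finset.piecewise, hij]
  have ht : Tendsto (fun F : Finset (K ⊕ Bool → Bool) => F.piecewise v u) atTop (𝓝 v) := by
    rw [tendsto_pi_nhds]
    intro j
    apply tendsto_const_nhds.congr'
    filter_upwards [eventually_ge_atTop {j}] with F hF
    have : j ∈ F := hF (by simp)
    simp [this]
  have h1 := (hg.tendsto v).comp ht
  have h2 : Tendsto (fun F : Finset (K ⊕ Bool → Bool) => g (F.piecewise v u)) atTop (𝓝 (g u)) := by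
    simp only [key]
    exact tendsto_const_nhds
  have h3 : g v = g u := tendsto_nhds_unique h1 h2
  rw [← hu, ← hv, h3] at hgap
  simp at hgap

lemma ess_iUnion {f : (ι → Bool) → ℝ} (hf : WC f) {K : Type*} [Countable K] [Nonempty K]
    {B : K → Set ι} (hB : Ess f 0 (⋃ n, B n)) : ∃ n, Ess f 0 (B n) := by
  classical
  obtain ⟨p, hp⟩ := piece hf (fun i n => decide (i ∈ B n)) hB
  by_cases h : ∃ n, p n = true
  · obtain ⟨n, hn⟩ := h
    refine ⟨n, hp.mono ?_ le_rfl⟩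
    rintro i ⟨-, hi⟩
    have := congrFun hi n
    rw [hn] at this
    simpa using this
  · push Not at h
    refine ⟨Classical.arbitrary K, hp.mono ?_ le_rfl⟩
    rintro i ⟨hi, hi2⟩
    obtain ⟨n, hn⟩ := Set.mem_iUnion.1 hi
    have := congrFun hi2 n
    exact absurd (this.symm.trans (by simpa using hn)) (h n)

lemma ess_union {f : (ι → Bool) → ℝ} (hf : WC f) 
    {B C : Set ι} (hB : Ess f 0 (B ∪ C)) : Ess f 0 B ∨ Ess f 0 C := by
  rw [Set.union_eq_iUnion] at hB
  obtain ⟨b, hb⟩ := ess_iUnion hf hB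
  cases b
  · exact Or.inr hb
  · exact Or.inl hb

/-- B can be cut by countably many sets into pieces that do not split. -/
def Fine (f : (ι → Bool) → ℝ) (ε : ℝ) (B : Set ι) : Prop :=
  ∃ T : Set (Set ι), T.Countable ∧ ∀ P, P ⊆ B → (∀ t ∈ T, P ⊆ t ∨ Disjoint P t) →
    ∀ C, C ⊆ P → Ess f ε C → Ess f ε (P \ C) → False

lemma not_fine {f : (ι → Bool) → ℝ} {ε : ℝ} {B : Set ι} (hB : ¬ Fine f ε B) :
    ∃ B', B' ⊆ B ∧ ¬ Fine f ε B' ∧ Ess f ε (B \ B') := by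
  by_contra! hno
  have h1 : ∃ C, C ⊆ B ∧ Ess f ε C ∧ Ess f ε (B \ C) := by
    by_contra! h
    apply hB
    refine ⟨∅, Set.countable_empty, fun P hP _ C hC h1 h2 => ?_⟩
    exact h C (hC.trans hP) h1 (h2.mono (Set.diff_subset_diff_left hP) le_rfl)
  obtain ⟨C, hCB, hC, hC'⟩ := h1
  have f1 : Fine f ε C := by
    by_contra h
    exact hno C hCB h hC'
  have f2 : Fine f ε (B \ C) := by
    by_contra h
    refine hno _ Set.diff_subset h ?_
    rwa [Set.diff_diff_cancel_left hCB]
  obtain ⟨T1, c1, h1⟩ := f1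
  obtain ⟨T2, c2, h2⟩ := f2
  apply hB
  refine ⟨insert C (T1 ∪ T2), (c1.union c2).insert C, ?_⟩
  intro P hP hT
  rcases hT C (Set.mem_insert _ _) with h | h
  · exact h1 P h fun t ht => hT t (Or.inr (Or.inl ht))
  · exact h2 P (fun i hi => ⟨hP hi, Set.disjoint_left.1 h hi⟩)
      fun t ht => hT t (Or.inr (Or.inr ht))

lemma fine {f : (ι → Bool) → ℝ} (hf : WC f) {ε : ℝ} (hε : 0 < ε) (B : Set ι) : Fine f ε B := by
  by_contra hB
  choose N hN1 hN2 hN3 using fun (D : {D : Set ι // ¬ Fine f ε D}) => not_fine D.2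
  let S : ℕ → {D : Set ι // ¬ Fine f ε D} :=
    fun n => Nat.rec ⟨B, hB⟩ (fun _ D => ⟨N D, hN2 D⟩) n
  have hS : ∀ n, (S (n + 1)).1 = N (S n) := fun n => rfl
  have hanti : Antitone (fun n => (S n).1) :=
    antitone_nat_of_succ_le fun n => by rw [hS]; exact hN1 _
  have hdis : ∀ m n, m < n → Disjoint ((S m).1 \ (S (m + 1)).1) ((S n).1 \ (S (n + 1)).1) := by
    intro m n hmn
    rw [Set.disjoint_left]
    rintro i ⟨-, h1⟩ ⟨h2, -⟩
    exact h1 (hanti (Nat.succ_le_of_lt hmn) h2)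
  refine no_seq hf hε (fun n => (S n).1 \ (S (n + 1)).1) ?_ ?_
  · intro m n hmn
    rcases lt_or_gt_of_ne hmn with h | h
    · exact hdis m n h
    · exact (hdis n m h).symm
  · intro n
    exact hN3 (S n)

lemma exists_atom {f : (ι → Bool) → ℝ} (hf : WC f) {E : Set ι} (hE : Ess f 0 E) :
    ∃ P, P ⊆ E ∧ Ess f 0 P ∧ ∀ C, C ⊆ P → Ess f 0 C → Ess f 0 (P \ C) → False := by
  classical
  choose T hTc hT using fun n : ℕ =>
    fine hf (ε := 1 / ((n : ℝ) + 1)) (by positivity) (Set.univ : Set ι)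
  have hc : (⋃ n, T n).Countable := Set.countable_iUnion hTc
  have : Countable (⋃ n, T n : Set (Set ι)) := hc.to_subtype
  obtain ⟨p, hp⟩ := piece hf
    (fun i (t : (⋃ n, T n : Set (Set ι))) => decide (i ∈ t.1)) hE
  refine ⟨_, Set.inter_subset_left, hp, ?_⟩
  intro C hC h1 h2
  obtain ⟨m, hm⟩ := h1.exists_nat
  obtain ⟨n, hn⟩ := h2.exists_nat
  have hle1 : 1 / (((max m n : ℕ) : ℝ) + 1) ≤ 1 / ((m : ℝ) + 1) :=
    Nat.one_div_le_one_div (le_max_left _ _)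
  have hle2 : 1 / (((max m n : ℕ) : ℝ) + 1) ≤ 1 / ((n : ℝ) + 1) :=
    Nat.one_div_le_one_div (le_max_right _ _)
  refine hT (max m n) _ (Set.subset_univ _) ?_ C hC (hm.mono subset_rfl hle1)
    (hn.mono subset_rfl hle2)
  intro t ht
  have htm : t ∈ ⋃ n, T n := Set.mem_iUnion.2 ⟨_, ht⟩
  by_cases hpt : p ⟨t, htm⟩ = true
  · left
    rintro i ⟨-, hi⟩
    have := congrFun hi ⟨t, htm⟩
    rw [hpt] at this
    simpa using this
  · right
    rw [Set.disjoint_left]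
    rintro i ⟨-, hi⟩ hit
    have := congrFun hi ⟨t, htm⟩
    exact hpt (this.symm.trans (by simpa using hit))

lemma atom_measurable {f : (ι → Bool) → ℝ} (hf : WC f) {P : Set ι} (hP : Ess f 0 P)
    (hatom : ∀ C, C ⊆ P → Ess f 0 C → Ess f 0 (P \ C) → False)
    (hs : ∀ i ∈ P, ¬ Ess f 0 {i}) : HasCountablyCompleteNonprincipalUltrafilter P := by
  let e : Set P → Prop := fun X => Ess f 0 (Subtype.val '' X)
  have emono : ∀ X Y, X ⊆ Y → e X → e Y := fun X Y h hX => hX.mono (Set.image_mono h) le_rfl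
  have hcim : ∀ X : Set P, Subtype.val '' Xᶜ = P \ (Subtype.val '' X) := by
    intro X
    ext i
    simp
  have euniv : e Set.univ := by
    simpa [e] using hP
  have ecompl : ∀ X, e Xᶜ ↔ ¬ e X := by
    intro X
    constructor
    · intro h1 h2
      refine hatom _ (by simp) h2 ?_
      rw [← hcim]
      exact h1
    · intro h
      have : e (X ∪ Xᶜ) := by rw [Set.union_compl_self]; exact euniv
      have h2 : Ess f 0 (Subtype.val '' X ∪ Subtype.val '' Xᶜ) := by
        rw [← Set.image_union]; exact this
      exact (ess_union hf h2).resolve_left h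
  have einter : ∀ (s : ℕ → Set P), (∀ n, e (s n)) → e (⋂ n, s n) := by
    intro s hs
    by_contra h
    rw [← ecompl, Set.compl_iInter] at h
    have h2 : Ess f 0 (⋃ n, Subtype.val '' (s n)ᶜ) := by
      rw [← Set.image_iUnion]; exact h
    obtain ⟨n, hn⟩ := ess_iUnion hf h2
    exact (ecompl (s n)).1 hn (hs n)
  let F : Filter P :=
    { sets := {X | e X}
      univ_sets := euniv
      sets_of_superset := fun {X Y} hX h => emono X Y h hX
      inter_sets := by
        intro X Y hX hY
        have := einter (fun n => if n = 0 then X else Y) (by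
          intro n
          by_cases h : n = 0
          · simpa [h] using hX
          · simpa [h] using hY)
        refine emono _ _ ?_ this
        intro i hi
        rw [Set.mem_iInter] at hi
        exact ⟨by simpa using hi 0, by simpa using hi 1⟩ }
  have hF : ∀ X, X ∈ F ↔ e X := fun X => Iff.rfl
  let U : Ultrafilter P := Ultrafilter.ofComplNotMemIff F (by
    intro X
    rw [hF, hF, ecompl, not_not])
  have hU : ∀ X, X ∈ U ↔ e X := fun X => Iff.rfl
  refine ⟨U, ?_, ?_⟩
  · intro a ha
    have : ({a} : Set P) ∈ U := by
      rw [ha]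
      exact Ultrafilter.mem_pure.2 rfl
    rw [hU] at this
    apply hs a.1 a.2
    simpa [e] using this
  · intro s h
    rw [hU]
    exact einter s fun n => (hU _).1 (h n)

lemma main {f : (ι → Bool) → ℝ} (hf : WC f)
    (hmeas : ∀ S : Set ι, ¬ HasCountablyCompleteNonprincipalUltrafilter S) : Continuous f := by
  classical
  let C : Set ι := {i | Ess f 0 {i}}
  have hC : C.Countable := by
    have hsub : C ⊆ ⋃ n : ℕ, {i | Ess f (1 / ((n : ℝ) + 1)) {i}} := by
      intro i hi
      obtain ⟨n, hn⟩ := Ess.exists_nat hi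
      exact Set.mem_iUnion.2 ⟨n, hn⟩
    refine Set.Countable.mono hsub (Set.countable_iUnion fun n => Set.Finite.countable ?_)
    by_contra hinf
    have hinf' : Set.Infinite {i | Ess f (1 / ((n : ℝ) + 1)) {i}} := hinf
    let φ := hinf'.natEmbedding
    refine no_seq hf (ε := 1 / ((n : ℝ) + 1)) (by positivity) (fun k => {(φ k).1}) ?_ ?_
    · intro a b hab
      rw [Set.disjoint_singleton]
      intro h
      exact hab (φ.injective (Subtype.ext h))
    · intro k
      exact (φ k).2
  have hE : ¬ Ess f 0 Cᶜ := by
    intro hE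
    obtain ⟨P, hPE, hP, hatom⟩ := exists_atom hf hE
    exact hmeas P (atom_measurable hf hP hatom fun i hi => hPE hi)
  have : Countable C := hC.to_subtype
  let extd : (C → Bool) → (ι → Bool) := fun u i => if h : i ∈ C then u ⟨i, h⟩ else false
  have hext : Continuous extd := by
    refine continuous_pi fun i => ?_
    by_cases h : i ∈ C
    · simp only [extd, h, dite_true]
      fun_prop
    · simp only [extd, h, dite_false]
      fun_prop
  have hg : Continuous (fun u => f (extd u)) := (hf.comp hext).continuous
  have heq : f = fun x => f (extd (fun c => x c.1)) := by
    funext x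
    by_contra hne
    apply hE
    refine ⟨_, _, ?_, abs_pos.2 (sub_ne_zero.2 hne)⟩
    intro i hi
    have hi' : i ∈ C := not_not.1 hi
    simp [extd, hi']
  rw [heq]
  exact hg.comp (f := fun (x : ι → Bool) (c : C) => x c.1) (by fun_prop)

end Usp

/-- (Uspenskii) If κ is infinite and below the first measurable cardinal, then every
ω-continuous real-valued function on the Cantor cube {0,1}^κ is continuous. -/
theorem uspenskii_cantor_cube
    {ι : Type*} [Infinite ι]
    (hmeas : ∀ S : Set ι, ¬ HasCountablyCompleteNonprincipalUltrafilter S)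
    (f : (ι → Bool) → ℝ)
    (hω : ∀ A : Set (ι → Bool), #A ≤ Cardinal.aleph0 → Continuous (A.restrict f)) :
    Continuous f := by
  exact Usp.main (fun A hA => continuousOn_iff_continuous_restrict.2
    (hω A (Cardinal.le_aleph0_iff_set_countable.2 hA))) hmeas
end

section
/- Let κ be an infinite cardinal and {X_α : α < λ} a family of compact Hausdorff spaces with t₀(X_α) ≤ κ for every α < λ. If λ is less than the first measurable cardinal, then t₀(∏_{α<λ} X_α) ≤ κ. -/
open Cardinal Set

open Filter Topology

/-- f is κ-continuous. -/
def KC (κ : Cardinal.{u}) {Y : Type u} [TopologicalSpace Y] (f : Y → ℝ) : Prop :=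
  ∀ A : Set Y, #A ≤ κ → ContinuousOn f A

theorem KC.tendsto {κ : Cardinal.{u}} (hκ : Cardinal.aleph0 ≤ κ) {Y : Type u}
    [TopologicalSpace Y] {f : Y → ℝ} (hf : KC κ f) {N : Type*} {l : Filter N} {x : N → Y}
    {z : Y} {B : Set Y} (hB : #B ≤ κ) (hx : ∀ᶠ n in l, x n ∈ B) (h : Tendsto x l (𝓝 z)) :
    Tendsto (fun n => f (x n)) l (𝓝 (f z)) := by
  have hB' : #(insert z B : Set Y) ≤ κ :=
    (Cardinal.mk_insert_le).trans
      (Cardinal.add_le_of_le hκ hB ((Cardinal.one_lt_aleph0.le).trans hκ))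
  have hc := hf _ hB' z (mem_insert _ _)
  refine Tendsto.comp hc (tendsto_nhdsWithin_iff.2 ⟨h, ?_⟩)
  filter_upwards [hx] with n hn using mem_insert_of_mem _ hn

theorem KC.comp {κ : Cardinal.{u}} {Y Z : Type u}
    [TopologicalSpace Y] [TopologicalSpace Z] {f : Z → ℝ} (hf : KC κ f) {φ : Y → Z}
    (hφ : Continuous φ) : KC κ (fun y => f (φ y)) := by
  intro A hA
  exact (hf (φ '' A) (Cardinal.mk_image_le.trans hA)).comp hφ.continuousOn (mapsTo_image _ _)

theorem KC.prod {κ : Cardinal.{u}} (hκ : Cardinal.aleph0 ≤ κ) {Y Z : Type u}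
    [TopologicalSpace Y] [TopologicalSpace Z] [CompactSpace Z]
    (hY : ∀ g : Y → ℝ, KC κ g → Continuous g) {h : Y × Z → ℝ} (hh : KC κ h)
    (hc : ∀ y, Continuous fun z => h (y, z)) : Continuous h := by
  let F : Y → C(Z, ℝ) := fun y => ⟨fun z => h (y, z), hc y⟩
  have hF : ∀ A : Set Y, #A ≤ κ → ContinuousOn F A := by
    intro A hA a ha
    rw [ContinuousWithinAt, Metric.tendsto_nhds]
    intro ε hε
    by_contra hcon
    have hfr : ∃ᶠ y in 𝓝[A] a, ¬ dist (F y) (F a) < ε := not_eventually.1 hcon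
    have hz : ∀ y, ∃ z, ¬ dist (F y) (F a) < ε → ε ≤ dist (h (y, z)) (h (a, z)) := by
      intro y
      by_cases hd : dist (F y) (F a) < ε
      · have : ∃ z : Z, True := by
          by_contra hne
          apply hcon
          filter_upwards with y
          rw [ContinuousMap.dist_lt_iff hε]
          intro z
          exact absurd ⟨z, trivial⟩ hne
        obtain ⟨z, -⟩ := this
        exact ⟨z, fun h => absurd hd h⟩
      · have h2 := hd
        rw [ContinuousMap.dist_lt_iff hε] at h2
        push Not at h2
        obtain ⟨z, hz⟩ := h2
        exact ⟨z, fun _ => hz⟩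
    choose z hz using hz
    have hne : NeBot (𝓝[A] a ⊓ 𝓟 {y | ¬ dist (F y) (F a) < ε}) :=
      frequently_mem_iff_neBot.1 hfr
    let U := Ultrafilter.of (𝓝[A] a ⊓ 𝓟 {y | ¬ dist (F y) (F a) < ε})
    have hU : (U : Filter Y) ≤ 𝓝[A] a ⊓ 𝓟 {y | ¬ dist (F y) (F a) < ε} := Ultrafilter.of_le _
    have hU1 : (U : Filter Y) ≤ 𝓝[A] a := hU.trans inf_le_left
    have hUA : ∀ᶠ y in (U : Filter Y), y ∈ A := hU1 self_mem_nhdsWithin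
    have hU2 : ∀ᶠ y in (U : Filter Y), ¬ dist (F y) (F a) < ε :=
      (hU.trans inf_le_right) (mem_principal_self _)
    obtain ⟨z0, -, hz0⟩ := isCompact_univ.ultrafilter_le_nhds (U.map z) (by simp)
    have hz0' : Tendsto z U (𝓝 z0) := hz0
    have hid : Tendsto (fun y : Y => y) U (𝓝 a) := hU1.trans nhdsWithin_le_nhds
    have hcard : #(A ×ˢ (z '' A) : Set (Y × Z)) ≤ κ := by
      rw [Cardinal.mk_setProd]
      exact Cardinal.mul_le_of_le hκ hA (Cardinal.mk_image_le.trans hA)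
    have t1 := hh.tendsto hκ hcard (l := (U : Filter Y)) (x := fun y => (y, z y)) (z := (a, z0))
      (by filter_upwards [hUA] with y hy using ⟨hy, mem_image_of_mem _ hy⟩)
      (hid.prodMk_nhds hz0')
    have t2 := hh.tendsto hκ hcard (l := (U : Filter Y)) (x := fun y => (a, z y)) (z := (a, z0))
      (by filter_upwards [hUA] with y hy using ⟨ha, mem_image_of_mem _ hy⟩)
      (tendsto_const_nhds.prodMk_nhds hz0')
    have t3 := t1.dist t2
    rw [dist_self] at t3
    have := ge_of_tendsto t3 (by filter_upwards [hU2] with y hy using hz y hy)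
    linarith
  have hFc : Continuous F := by
    rw [continuous_iff_continuousAt]
    intro a
    have : Continuous fun y => dist (F y) (F a) := by
      apply hY
      intro A hA
      exact fun y hy => Filter.Tendsto.dist (hF A hA y hy) tendsto_const_nhds
    rw [ContinuousAt, tendsto_iff_dist_tendsto_zero]
    have h2 := this.tendsto a
    rwa [dist_self] at h2
  have : h = fun q : Y × Z => (F q.1) q.2 := rfl
  rw [this]
  exact (hFc.comp continuous_fst).eval continuous_snd

set_option linter.unusedSectionVars false

section
variable {κ : Cardinal.{u}} {ι : Type u} {X : ι → Type u} [∀ i, TopologicalSpace (X i)]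

theorem KC.finset [∀ i, CompactSpace (X i)] [DecidableEq ι] (hκ : Cardinal.aleph0 ≤ κ)
    (ht0 : ∀ i, ∀ g : X i → ℝ, KC κ g → Continuous g) (p : ∀ i, X i) (G : Finset ι) :
    ∀ f : (∀ i, X i) → ℝ, KC κ f → Continuous fun x => f (G.piecewise x p) := by
  induction G using Finset.induction_on with
  | empty => intro f hf; simpa using continuous_const
  | insert a G ha ih =>
    intro f hf
    have hpw : Continuous fun z : ∀ i, X i => G.piecewise z p := by
      refine continuous_pi fun i => ?_
      by_cases hi : i ∈ G
      · simpa [hi] using continuous_apply i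
      · simpa [hi] using continuous_const
    have hφ : Continuous fun q : X a × (∀ i, X i) =>
        Function.update (G.piecewise q.2 p) a q.1 :=
      (hpw.comp continuous_snd).update a continuous_fst
    have key := KC.prod hκ (ht0 a) (hf.comp hφ) (fun t => by
      have := ih (fun z => f (Function.update z a t))
        (hf.comp (continuous_id.update a continuous_const))
      exact this)
    have h2 := key.comp ((continuous_apply a).prodMk continuous_id : Continuous
      fun x : (∀ i, X i) => (x a, x))
    convert h2 using 2 with x
    simp [Finset.piecewise_insert]

/-- f varies by at most ε when the coordinates in S change. -/
def Sml (f : (∀ i, X i) → ℝ) (ε : ℝ) (S : Set ι) : Prop :=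
  ∀ x y, (∀ i, i ∉ S → x i = y i) → |f x - f y| ≤ ε

theorem Sml.mono {f : (∀ i, X i) → ℝ} {ε : ℝ} {S T : Set ι} (h : Sml f ε T) (hS : S ⊆ T) :
    Sml f ε S := fun x y hxy => h x y fun i hi => hxy i fun h' => hi (hS h')

theorem Sml.union {f : (∀ i, X i) → ℝ} {a b : ℝ} {S T : Set ι} (h : Sml f a S)
    (h' : Sml f b T) : Sml f (a + b) (S ∪ T) := by
  classical
  intro x y hxy
  have h1 := h x (S.piecewise y x) (fun i hi => by simp [hi])
  have h2 := h' (S.piecewise y x) y (fun i hi => by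
    by_cases hs : i ∈ S
    · simp [hs]
    · simpa [hs] using hxy i (by simp [hs, hi]))
  calc |f x - f y| ≤ _ := abs_sub_le _ (f (S.piecewise y x)) _
    _ ≤ _ := add_le_add h1 h2

theorem Sml.sUnion {f : (∀ i, X i) → ℝ} {ε : ℝ} (D : Finset (Set ι))
    (h : ∀ c ∈ D, Sml f ε c) : Sml f (D.card * ε) (⋃₀ (D : Set (Set ι))) := by
  classical
  induction D using Finset.induction_on with
  | empty =>
    intro x y hxy
    have : x = y := funext fun i => hxy i (by simp)
    simp [this]
  | insert a D ha ih =>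
    have := (h a (by simp)).union (ih fun c hc => h c (by simp [hc]))
    rw [Finset.card_insert_of_notMem ha, Finset.coe_insert, sUnion_insert]
    convert this using 1
    push_cast; ring

theorem exists_sml [∀ i, CompactSpace (X i)] (hκ : Cardinal.aleph0 ≤ κ)
    {f : (∀ i, X i) → ℝ} (hf : KC κ f) {ε : ℝ} (hε : 0 < ε) (S : ℕ → Set ι)
    (hS : ∀ i, ∀ᶠ n in atTop, i ∉ S n) : ∃ n, Sml f ε (S n) := by
  by_contra hcon
  simp only [Sml] at hcon
  push Not at hcon
  choose x y hxy hd using hcon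
  let U : Ultrafilter ℕ := hyperfilter ℕ
  have hU : (U : Filter ℕ) ≤ atTop := by
    rw [← Nat.cofinite_eq_atTop]; exact hyperfilter_le_cofinite
  obtain ⟨z, -, hz⟩ := isCompact_univ.ultrafilter_le_nhds (U.map x) (by simp)
  have hz' : Tendsto x U (𝓝 z) := hz
  have hy : Tendsto y U (𝓝 z) := by
    rw [tendsto_pi_nhds] at hz' ⊢
    intro i
    refine (hz' i).congr' ?_
    filter_upwards [hU (hS i)] with n hn using hxy n i hn
  have hc : ∀ w : ℕ → ∀ i, X i, #(range w) ≤ κ := fun w =>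
    (Cardinal.le_aleph0_iff_set_countable.2 (countable_range w)).trans hκ
  have t1 := hf.tendsto hκ (hc x) (Eventually.of_forall fun n => mem_range_self n) hz'
  have t2 := hf.tendsto hκ (hc y) (Eventually.of_forall fun n => mem_range_self n) hy
  have t3 := (t1.sub t2).abs
  rw [sub_self, abs_zero] at t3
  have := ge_of_tendsto t3 (Eventually.of_forall fun n => (hd n).le)
  linarith

theorem finite_big [∀ i, CompactSpace (X i)] (hκ : Cardinal.aleph0 ≤ κ)
    {f : (∀ i, X i) → ℝ} (hf : KC κ f) {ε : ℝ} (hε : 0 < ε) :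
    {a : ι | ¬ Sml f ε {a}}.Finite := by
  by_contra hinf
  let e := Set.Infinite.natEmbedding _ hinf
  obtain ⟨n, hn⟩ := exists_sml hκ hf hε (fun n => {(e n : ι)}) (by
    intro i
    by_cases h : ∃ n, (e n : ι) = i
    · obtain ⟨n, rfl⟩ := h
      filter_upwards [eventually_gt_atTop n] with m hm h
      have : e n = e m := Subtype.ext h
      exact hm.ne (e.injective this)
    · exact Eventually.of_forall fun n hn => h ⟨n, hn.symm⟩)
  exact (e n).2 hn

/-- S is covered by finitely many small sets. -/
def FinSml (f : (∀ i, X i) → ℝ) (ε : ℝ) (S : Set ι) : Prop :=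
  ∃ C : Finset (Set ι), (∀ c ∈ C, Sml f ε c) ∧ S ⊆ ⋃₀ (C : Set (Set ι))

theorem FinSml.mono {f : (∀ i, X i) → ℝ} {ε : ℝ} {S T : Set ι} (h : FinSml f ε T)
    (hS : S ⊆ T) : FinSml f ε S := by
  obtain ⟨C, h1, h2⟩ := h
  exact ⟨C, h1, hS.trans h2⟩

theorem FinSml.union {f : (∀ i, X i) → ℝ} {ε : ℝ} {S T : Set ι} (h : FinSml f ε S)
    (h' : FinSml f ε T) : FinSml f ε (S ∪ T) := by
  classical
  obtain ⟨C, h1, h2⟩ := h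
  obtain ⟨D, h3, h4⟩ := h'
  refine ⟨C ∪ D, fun c hc => ?_, ?_⟩
  · rcases Finset.mem_union.1 hc with h | h
    exacts [h1 c h, h3 c h]
  · rw [Finset.coe_union, sUnion_union]
    exact union_subset_union h2 h4

theorem Sml.fin {f : (∀ i, X i) → ℝ} {ε : ℝ} {S : Set ι} (h : Sml f ε S) : FinSml f ε S :=
  ⟨{S}, by simpa using h, by simp⟩

theorem finSml_of_singletons [∀ i, CompactSpace (X i)] (hκ : Cardinal.aleph0 ≤ κ)
    (hmeas : ∀ S : Set ι, ¬ HasCountablyCompleteNonprincipalUltrafilter S)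
    {f : (∀ i, X i) → ℝ} (hf : KC κ f) {ε : ℝ} (hε : 0 < ε) (T : Set ι)
    (hT : ∀ a ∈ T, Sml f ε {a}) : FinSml f ε T := by
  by_contra hTn
  have hsplit : ∃ S, S ⊆ T ∧ ¬ FinSml f ε S ∧
      ∀ A, A ⊆ S → FinSml f ε A ∨ FinSml f ε (S \ A) := by
    by_contra hcon
    push Not at hcon
    have hs : ∀ S : {S : Set ι // S ⊆ T ∧ ¬ FinSml f ε S},
        ∃ A : {S : Set ι // S ⊆ T ∧ ¬ FinSml f ε S}, A.1 ⊆ S.1 ∧ ¬ FinSml f ε (S.1 \ A.1) := by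
      rintro ⟨S, h1, h2⟩
      obtain ⟨A, hA, h3, h4⟩ := hcon S h1 h2
      exact ⟨⟨A, hA.trans h1, h3⟩, hA, h4⟩
    choose A hA1 hA2 using hs
    let S : ℕ → {S : Set ι // S ⊆ T ∧ ¬ FinSml f ε S} := fun n => A^[n] ⟨T, Subset.rfl, hTn⟩
    have hSs : ∀ n, S (n + 1) = A (S n) := fun n => Function.iterate_succ_apply' _ _ _
    have hanti : Antitone fun n => (S n).1 := antitone_nat_of_succ_le fun n => by
      rw [hSs]; exact hA1 _
    obtain ⟨n, hn⟩ := exists_sml hκ hf hε (fun n => (S n).1 \ (S (n+1)).1) (by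
      intro i
      by_cases h : ∃ n, i ∈ (S n).1 \ (S (n+1)).1
      · obtain ⟨n, hn⟩ := h
        filter_upwards [eventually_gt_atTop n] with m hm h
        exact hn.2 (hanti (Nat.succ_le_of_lt hm) h.1)
      · exact Eventually.of_forall fun n hn => h ⟨n, hn⟩)
    apply hA2 (S n)
    rw [← hSs]
    exact hn.fin
  obtain ⟨S, hST, hSn, hS⟩ := hsplit
  let L : Filter S :=
    { sets := {s | FinSml f ε ((↑) '' sᶜ : Set ι)}
      univ_sets := by
        refine ⟨∅, by simp, by simp⟩
      sets_of_superset := by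
        intro s t hs hst
        exact FinSml.mono hs (image_mono (compl_subset_compl.2 hst))
      inter_sets := by
        intro s t hs ht
        simp only [mem_setOf_eq, compl_inter, image_union] at *
        exact hs.union ht }
  have hL : ∀ s : Set S, s ∈ L ↔ FinSml f ε ((↑) '' sᶜ : Set ι) := fun s => Iff.rfl
  have hcup : ∀ s : Set S, (S : Set ι) = ((↑) '' s) ∪ ((↑) '' sᶜ) := by
    intro s; rw [← image_union, union_compl_self]; simp
  have hultra : ∀ s : Set S, sᶜ ∉ L ↔ s ∈ L := by
    intro s
    rw [hL, hL, compl_compl]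
    constructor
    · intro h
      rcases hS ((↑) '' s) (by simp) with h1 | h1
      · exact absurd h1 h
      · refine h1.mono ?_
        rintro _ ⟨a, ha, rfl⟩
        exact ⟨a.2, by simpa using ha⟩
    · intro h h'
      apply hSn
      rw [hcup s]
      exact h'.union h
  let U := Ultrafilter.ofComplNotMemIff L hultra
  have hU : ∀ s : Set S, s ∈ U ↔ FinSml f ε ((↑) '' sᶜ : Set ι) := fun s => Iff.rfl
  refine hmeas S ⟨U, ?_, ?_⟩
  · intro a ha
    have : ({a} : Set S) ∈ U := by rw [ha]; exact Set.mem_singleton a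
    rw [hU] at this
    apply hSn
    rw [hcup {a}]
    refine FinSml.union ?_ this
    rw [image_singleton]
    exact (hT a (hST a.2)).fin
  · intro s hs
    by_contra hcon
    rw [← Ultrafilter.compl_mem_iff_notMem, hU, compl_compl] at hcon
    obtain ⟨n, hn⟩ := exists_sml hκ hf hε
      (fun n => ((↑) '' ((⋂ k ∈ Finset.range n, s k) \ ⋂ k, s k) : Set ι)) (by
        intro i
        by_cases h : ∃ n, ∃ hi : i ∈ S, (⟨i, hi⟩ : S) ∉ s n
        · obtain ⟨n, hi, hn⟩ := h
          filter_upwards [eventually_gt_atTop n] with m hm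
          rintro ⟨a, ha, rfl⟩
          apply hn
          have := ha.1
          simp only [mem_iInter] at this
          exact this n (Finset.mem_range.2 hm)
        · push Not at h
          refine Eventually.of_forall fun n => ?_
          rintro ⟨a, ha, rfl⟩
          exact ha.2 (mem_iInter.2 fun k => h k a.2))
    have hmem : (⋂ k ∈ Finset.range n, s k) ∈ U :=
      (Filter.biInter_finset_mem (f := (U : Filter S)) _).2 fun k _ => hs k
    rw [hU] at hmem
    apply hSn
    rw [hcup (⋂ k ∈ Finset.range n, s k)]
    refine FinSml.union ((hn.fin.union hcon).mono ?_) hmem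
    rw [← image_union]
    exact image_mono (by rw [diff_union_self]; exact subset_union_left)

theorem sml_zero (hκ : Cardinal.aleph0 ≤ κ) {f : (∀ i, X i) → ℝ} (hf : KC κ f) (T : Set ι)
    (hT : ∀ n : ℕ, FinSml f (1 / ((n : ℝ) + 1)) T) : Sml f 0 T := by
  classical
  choose C hC hCT using hT
  intro x y hxy
  have hcell : ∀ (n : ℕ) (t : ι), ∃ c : Set ι, t ∈ T → c ∈ C n ∧ t ∈ c := by
    intro n t
    by_cases ht : t ∈ T
    · obtain ⟨c, hc, htc⟩ := hCT n ht
      exact ⟨c, fun _ => ⟨hc, htc⟩⟩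
    · exact ⟨∅, fun h => absurd h ht⟩
  choose c hc using hcell
  let z : Finset (Set ι) → ∀ i, X i := fun D => (⋃₀ (D : Set (Set ι))).piecewise x y
  let B : Set (∀ i, X i) := ⋃ n, z '' ((C n).powerset : Set (Finset (Set ι)))
  have hB : #B ≤ κ := by
    refine le_trans (Cardinal.le_aleph0_iff_set_countable.2 ?_) hκ
    exact countable_iUnion fun n => ((Finset.finite_toSet _).image _).countable
  refine le_of_forall_pos_le_add fun δ hδ => ?_
  rw [zero_add]
  have hn : ∀ G : Finset ι, ∃ n : ℕ, (G.card : ℝ) * (1 / ((n : ℝ) + 1)) ≤ δ := by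
    intro G
    obtain ⟨n, hn⟩ := exists_nat_ge ((G.card : ℝ) / δ)
    refine ⟨n, ?_⟩
    rw [div_le_iff₀ hδ] at hn
    rw [mul_one_div, div_le_iff₀ (by positivity)]
    nlinarith
  choose n hn using hn
  let D : Finset ι → Finset (Set ι) := fun G => (G.filter (· ∈ T)).image (c (n G))
  have hDC : ∀ G, D G ⊆ C (n G) := by
    intro G d hd
    obtain ⟨t, ht, rfl⟩ := Finset.mem_image.1 hd
    exact (hc _ t (Finset.mem_filter.1 ht).2).1
  have ht : Tendsto (fun G => z (D G)) atTop (𝓝 x) := by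
    rw [tendsto_pi_nhds]
    intro i
    refine tendsto_const_nhds.congr' ?_
    filter_upwards [eventually_ge_atTop {i}] with G hG
    have hiG : i ∈ G := hG (Finset.mem_singleton_self i)
    by_cases hi : i ∈ ⋃₀ (D G : Set (Set ι))
    · simp only [z]; rw [Set.piecewise_eq_of_mem _ _ _ hi]
    · simp only [z]; rw [Set.piecewise_eq_of_notMem _ _ _ hi]
      apply hxy
      intro hiT
      apply hi
      exact ⟨c (n G) i, Finset.mem_coe.2 (Finset.mem_image.2
        ⟨i, Finset.mem_filter.2 ⟨hiG, hiT⟩, rfl⟩), (hc _ i hiT).2⟩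
  have t1 := hf.tendsto hκ hB (Eventually.of_forall fun G =>
    mem_iUnion.2 ⟨n G, mem_image_of_mem z (Finset.mem_coe.2 (Finset.mem_powerset.2 (hDC G)))⟩) ht
  have t2 := (t1.sub_const (f y)).abs
  refine le_of_tendsto t2 (Eventually.of_forall fun G => ?_)
  have h1 := Sml.sUnion (f := f) (D G) (fun d hd => hC _ d (hDC G hd)) (z (D G)) y
    (fun i hi => by simp only [z]; rw [Set.piecewise_eq_of_notMem _ _ _ hi])
  refine h1.trans (le_trans ?_ (hn G))
  have : (D G).card ≤ G.card := Finset.card_image_le.trans (Finset.card_filter_le _ _)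
  have h3 : ((D G).card : ℝ) ≤ G.card := by exact_mod_cast this
  exact mul_le_mul_of_nonneg_right h3 (by positivity)

theorem exists_finset_sml [∀ i, CompactSpace (X i)] (hκ : Cardinal.aleph0 ≤ κ)
    (hmeas : ∀ S : Set ι, ¬ HasCountablyCompleteNonprincipalUltrafilter S)
    {f : (∀ i, X i) → ℝ} (hf : KC κ f) {ε : ℝ} (hε : 0 < ε) :
    ∃ G : Finset ι, Sml f ε (G : Set ι)ᶜ := by
  classical
  let F : ℕ → Set ι := fun n => {a | ¬ Sml f (1 / ((n : ℝ) + 1)) {a}}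
  have hF : ∀ n, (F n).Finite := fun n => finite_big hκ hf (by positivity)
  have hT : Sml f 0 (⋃ n, F n)ᶜ := by
    apply sml_zero hκ hf
    intro n
    apply finSml_of_singletons hκ hmeas hf (by positivity)
    intro a ha
    by_contra h
    exact ha (mem_iUnion.2 ⟨n, h⟩)
  let G : ℕ → Finset ι := fun n => (Finset.range n).biUnion fun k => (hF k).toFinset
  obtain ⟨n, hn⟩ := exists_sml hκ hf hε (fun n => (⋃ n, F n) \ (G n : Set ι)) (by
    intro i
    by_cases h : ∃ n, i ∈ F n
    · obtain ⟨n, hn⟩ := h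
      filter_upwards [eventually_gt_atTop n] with m hm h
      apply h.2
      simp only [G, Finset.coe_biUnion, mem_iUnion]
      exact ⟨n, by simpa using hm, by simpa using hn⟩
    · exact Eventually.of_forall fun n hn => h (mem_iUnion.1 hn.1))
  refine ⟨G n, ?_⟩
  have := hT.union hn
  rw [zero_add] at this
  refine this.mono fun i hi => ?_
  by_cases h : i ∈ ⋃ n, F n
  · exact Or.inr ⟨h, hi⟩
  · exact Or.inl h

end

/-- If λ is below the first measurable cardinal, the product of λ many compact
Hausdorff spaces of functional tightness ≤ κ has functional tightness ≤ κ. -/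
theorem functionalTightness_product_below_measurable
    (κ : Cardinal.{u}) (hκ : Cardinal.aleph0 ≤ κ)
    {ι : Type u}
    (hmeas : ∀ S : Set ι, ¬ HasCountablyCompleteNonprincipalUltrafilter S)
    {X : ι → Type u} [∀ i, TopologicalSpace (X i)]
    [∀ i, CompactSpace (X i)] [∀ i, T2Space (X i)]
    (ht0 : ∀ i, ∀ g : X i → ℝ,
      (∀ A : Set (X i), #A ≤ κ → Continuous (A.restrict g)) → Continuous g)
    (f : (∀ i, X i) → ℝ)
    (hkappa : ∀ A : Set (∀ i, X i), #A ≤ κ → Continuous (A.restrict f)) :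
    Continuous f := by
  classical
  have hf : KC κ f := fun A hA => continuousOn_iff_continuous_restrict.2 (hkappa A hA)
  have ht : ∀ i, ∀ g : X i → ℝ, KC κ g → Continuous g := fun i g hg =>
    ht0 i g fun A hA => continuousOn_iff_continuous_restrict.1 (hg A hA)
  rw [continuous_iff_continuousAt]
  intro p
  have : Continuous f := by
    refine continuous_of_uniform_approx_of_continuous fun u hu => ?_
    obtain ⟨ε, hε, hεu⟩ := Metric.mem_uniformity_dist.1 hu
    obtain ⟨G, hG⟩ := exists_finset_sml hκ hmeas hf (half_pos hε)
    refine ⟨_, KC.finset hκ ht p G f hf, fun y => hεu ?_⟩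
    rw [Real.dist_eq]
    refine lt_of_le_of_lt (hG _ _ fun i hi => ?_) (half_lt_self hε)
    have hi' : i ∈ G := by simpa using hi
    simp [hi']
  exact this.continuousAt
end
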